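/- Let W be an xy-symmetric weight function on a measurable set Ω ⊆ ℝ² and let {Sₙ} be the MOPS of W on Ω. Suppose that for each n ≥ 0 and 0 ≤ k ≤ n there is a real bivariate polynomial s_{n,k} such that S_{2n+1,2k+1}(x,y) = y·s_{n,k}(x²,y²) for all (x,y). Then each s_{n,k} is monic with s_{n,k}(u,v) = u^{n−k} v^k + (terms of total degree < n), and the vectors Ŝₙ = (s_{n,0},…,s_{n,n})ᵀ form the MOPS of the weight W^{(0,1)} on Ω*: ∫_{Ω*} Ŝₙ(u,v) Ŝₘ(u,v)ᵀ W^{(0,1)}(u,v) du dv = 0 whenever n ≠ m. -/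

import Mathlib

noncomputable section

open MeasureTheory MvPolynomial

/-- Evaluation of a bivariate polynomial at a point of `ℝ × ℝ`. -/
def ev (p : ℝ × ℝ) (f : MvPolynomial (Fin 2) ℝ) : ℝ := eval ![p.1, p.2] f

/-- `W` is a weight function on the measurable set `Ω ⊆ ℝ²`: nonnegative and measurable,
positive on a set of positive Lebesgue measure, with all moments finite. -/
def IsWeight (Ω : Set (ℝ × ℝ)) (W : ℝ × ℝ → ℝ) : Prop :=
  MeasurableSet Ω ∧ Measurable W ∧ (∀ p ∈ Ω, 0 ≤ W p) ∧
    0 < volume {p | p ∈ Ω ∧ 0 < W p} ∧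
    ∀ h k : ℕ, IntegrableOn (fun p : ℝ × ℝ => p.1 ^ h * p.2 ^ k * W p) Ω

/-- `W` is an `xy`-symmetric weight on `Ω`: `Ω` is invariant under `(x,y) ↦ (-x,y)` and
`(x,y) ↦ (x,-y)`, and `W(-x,y) = W(x,y) = W(x,-y)` on `Ω`. -/
def XYSymmetric (Ω : Set (ℝ × ℝ)) (W : ℝ × ℝ → ℝ) : Prop :=
  (∀ p : ℝ × ℝ, p ∈ Ω → (-p.1, p.2) ∈ Ω ∧ (p.1, -p.2) ∈ Ω) ∧
    ∀ p ∈ Ω, W (-p.1, p.2) = W p ∧ W (p.1, -p.2) = W p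

/-- `f` is monic of the form `x^(n-j) y^j + (terms of total degree < n)`. -/
def MonicLead (n j : ℕ) (f : MvPolynomial (Fin 2) ℝ) : Prop :=
  f = X 0 ^ (n - j) * X 1 ^ j ∨ (f - X 0 ^ (n - j) * X 1 ^ j).totalDegree < n

/-- `P` is the monic orthogonal polynomial system (MOPS) of the weight `W` on `Ω`:
each `P n j` is monic with leading term `x^(n-j) y^j`, and vectors of different degrees
are mutually orthogonal. -/
def IsMOPS (Ω : Set (ℝ × ℝ)) (W : ℝ × ℝ → ℝ)
    (P : (n : ℕ) → Fin (n + 1) → MvPolynomial (Fin 2) ℝ) : Prop :=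
  (∀ (n : ℕ) (j : Fin (n + 1)), MonicLead n (j : ℕ) (P n j)) ∧
    ∀ m n : ℕ, m ≠ n → ∀ (i : Fin (m + 1)) (j : Fin (n + 1)),
      ∫ p in Ω, ev p (P m i) * ev p (P n j) * W p = 0

/-- The image domain `Ω* = {(u,v) : u ≥ 0, v ≥ 0, (√u, √v) ∈ Ω}`. -/
def Ωstar (Ω : Set (ℝ × ℝ)) : Set (ℝ × ℝ) :=
  {q | 0 ≤ q.1 ∧ 0 ≤ q.2 ∧ (Real.sqrt q.1, Real.sqrt q.2) ∈ Ω}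

/-- The weight `W^(0,0)(u,v) = (1/4) (uv)^(-1/2) W(√u, √v)` on `Ω*`. -/
def W00 (W : ℝ × ℝ → ℝ) : ℝ × ℝ → ℝ :=
  fun q => (1 / 4) * W (Real.sqrt q.1, Real.sqrt q.2) / Real.sqrt (q.1 * q.2)

open Set in
/-- Iterated integrals over the open first quadrant under the substitution
`(u, v) = (x ^ 2, y ^ 2)`. -/
theorem integral_Ioi_Ioi_comp_sq (H : ℝ × ℝ → ℝ) :
    ∫ x in Ioi (0 : ℝ), ∫ y in Ioi (0 : ℝ), 4 * x * y * H (x ^ 2, y ^ 2) =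
      ∫ u in Ioi (0 : ℝ), ∫ v in Ioi (0 : ℝ), H (u, v) := by
  have subst_sq (g : ℝ → ℝ) :
      ∫ x in Ioi (0 : ℝ), 2 * x * g (x ^ 2) = ∫ u in Ioi (0 : ℝ), g u := by
    rw [← integral_comp_rpow_Ioi_of_pos (g := g) two_pos]
    refine setIntegral_congr_fun measurableSet_Ioi fun x _ => ?_
    norm_num
  rw [← subst_sq fun u => ∫ v in Ioi (0 : ℝ), H (u, v)]
  refine setIntegral_congr_fun measurableSet_Ioi fun x _ => ?_
  rw [← subst_sq fun v => H (x ^ 2, v), ← integral_const_mul]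
  congr with y
  ring

open Set in
/-- The integral of a function that is even in each variable, as an iterated integral over the
open first quadrant. -/
theorem integral_eq_four_mul_integral_Ioi_Ioi {F : ℝ × ℝ → ℝ} (hF : Integrable F)
    (hx : ∀ x y, F (-x, y) = F (x, y)) (hy : ∀ x y, F (x, -y) = F (x, y)) :
    ∫ p, F p = 4 * ∫ x in Ioi (0 : ℝ), ∫ y in Ioi (0 : ℝ), F (x, y) := by
  have hx' (x y : ℝ) : F (|x|, y) = F (x, y) := by
    rcases abs_choice x with h | h <;> simp [h, hx]
  have hy' (x y : ℝ) : F (x, |y|) = F (x, y) := by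
    rcases abs_choice y with h | h <;> simp [h, hy]
  have inner (x : ℝ) : ∫ y, F (x, y) = 2 * ∫ y in Ioi (0 : ℝ), F (x, y) := by
    rw [← integral_comp_abs (f := fun y => F (x, y))]
    simp only [hy']
  have outer := integral_comp_abs (f := fun x => ∫ y in Ioi (0 : ℝ), F (x, y))
  simp only [hx'] at outer
  rw [Measure.volume_eq_prod] at hF ⊢
  rw [integral_prod _ hF]
  simp only [inner]
  rw [integral_const_mul, outer]
  ring

open Set in
/-- The integral of a function supported in the open first quadrant, as an iterated integral. -/
theorem integral_eq_integral_Ioi_Ioi {H : ℝ × ℝ → ℝ} (hH : Integrable H)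
    (hsupp : ∀ u v, H (u, v) ≠ 0 → 0 < u ∧ 0 < v) :
    ∫ q, H q = ∫ u in Ioi (0 : ℝ), ∫ v in Ioi (0 : ℝ), H (u, v) := by
  have inner (u : ℝ) : ∫ v in Ioi (0 : ℝ), H (u, v) = ∫ v, H (u, v) :=
    setIntegral_eq_integral_of_forall_compl_eq_zero fun v hv => by
      by_contra h
      exact hv (hsupp u v h).2
  rw [Measure.volume_eq_prod] at hH ⊢
  simp only [inner]
  rw [integral_prod _ hH, setIntegral_eq_integral_of_forall_compl_eq_zero]
  intro u hu
  have h0 (v : ℝ) : H (u, v) = 0 := by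
    by_contra h
    exact hu (hsupp u v h).1
  simp [h0]

theorem IsWeight.integrableOn_ev_mul {Ω : Set (ℝ × ℝ)} {W : ℝ × ℝ → ℝ} (hW : IsWeight Ω W)
    (f : MvPolynomial (Fin 2) ℝ) : IntegrableOn (fun p => ev p f * W p) Ω := by
  simp only [ev, eval_eq', Finset.sum_mul, Fin.prod_univ_two]
  refine integrable_finsetSum _ fun d _ => ?_
  simpa [mul_assoc] using (hW.2.2.2.2 (d 0) (d 1)).const_mul (f.coeff d)

theorem measurableSet_Ωstar {Ω : Set (ℝ × ℝ)} (hΩ : MeasurableSet Ω) :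
    MeasurableSet (Ωstar Ω) := by
  have hsqrt : Measurable fun q : ℝ × ℝ => (Real.sqrt q.1, Real.sqrt q.2) := by fun_prop
  exact (measurableSet_le measurable_const measurable_fst).inter
    ((measurableSet_le measurable_const measurable_snd).inter (hsqrt hΩ))

theorem MonicLead.of_eq_X_mul_expand {n k : ℕ} (hk : k ≤ n) {f g : MvPolynomial (Fin 2) ℝ}
    (hf : MonicLead (2 * n + 1) (2 * k + 1) f) (hfg : f = X 1 * expand 2 g) :
    MonicLead n k g := by
  by_cases hg : g - X 0 ^ (n - k) * X 1 ^ k = 0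
  · exact Or.inl (sub_eq_zero.mp hg)
  have hdiff : f - X 0 ^ (2 * n + 1 - (2 * k + 1)) * X 1 ^ (2 * k + 1) =
      X 1 * expand 2 (g - X 0 ^ (n - k) * X 1 ^ k) := by
    have hexp : 2 * n + 1 - (2 * k + 1) = 2 * (n - k) := by omega
    rw [hfg, hexp]
    simp only [map_sub, map_mul, map_pow, expand_X]
    ring
  have hne := (expand_ne_zero two_pos).mpr hg
  rcases hf with hf | hf
  · rw [← sub_eq_zero, hdiff] at hf
    exact absurd hf (mul_ne_zero (X_ne_zero 1) hne)
  · rw [hdiff, totalDegree_mul_of_isDomain (X_ne_zero 1) hne, totalDegree_X,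
      totalDegree_expand] at hf
    exact Or.inr (by omega)

open Set in
/-- Integration of `y² f(x², y²) W(x, y)` over `Ω` reduces to integration against the
weight `v W^(0,0)(u, v)` on `Ω*`, as far as vanishing is concerned. -/
theorem integral_Ωstar_eq_zero {Ω : Set (ℝ × ℝ)} {W : ℝ × ℝ → ℝ} (hΩ : MeasurableSet Ω)
    (hsym : XYSymmetric Ω W) (f : ℝ × ℝ → ℝ)
    (hint : IntegrableOn (fun p => p.2 ^ 2 * f (p.1 ^ 2, p.2 ^ 2) * W p) Ω)
    (hzero : ∫ p in Ω, p.2 ^ 2 * f (p.1 ^ 2, p.2 ^ 2) * W p = 0) :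
    ∫ q in Ωstar Ω, f q * (q.2 * W00 W q) = 0 := by
  set H : ℝ × ℝ → ℝ := (Ωstar Ω).indicator fun q => f q * (q.2 * W00 W q) with hHdef
  set F : ℝ × ℝ → ℝ := Ω.indicator fun p => p.2 ^ 2 * f (p.1 ^ 2, p.2 ^ 2) * W p with hFdef
  rw [← integral_indicator (measurableSet_Ωstar hΩ), ← hHdef]
  rw [← integral_indicator hΩ, ← hFdef] at hzero
  rw [← integrable_indicator_iff hΩ, ← hFdef] at hint
  by_cases hH : Integrable H
  swap
  · exact integral_undef hH
  have hsupp (u v : ℝ) (h : H (u, v) ≠ 0) : 0 < u ∧ 0 < v := by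
    have hmem : (u, v) ∈ Ωstar Ω := mem_of_indicator_ne_zero h
    rw [hHdef, indicator_of_mem hmem] at h
    refine ⟨hmem.1.lt_of_ne' ?_, hmem.2.1.lt_of_ne' ?_⟩ <;>
    · rintro rfl
      simp [W00] at h
  have hx (x y : ℝ) : F (-x, y) = F (x, y) := by
    by_cases h : (x, y) ∈ Ω
    · rw [hFdef, indicator_of_mem h, indicator_of_mem (hsym.1 _ h).1]
      simp [(hsym.2 _ h).1]
    · have h' : (-x, y) ∉ Ω := fun h' => h (by simpa using (hsym.1 _ h').1)
      rw [hFdef, indicator_of_notMem h, indicator_of_notMem h']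
  have hy (x y : ℝ) : F (x, -y) = F (x, y) := by
    by_cases h : (x, y) ∈ Ω
    · rw [hFdef, indicator_of_mem h, indicator_of_mem (hsym.1 _ h).2]
      simp [(hsym.2 _ h).2]
    · have h' : (x, -y) ∉ Ω := fun h' => h (by simpa using (hsym.1 _ h').2)
      rw [hFdef, indicator_of_notMem h, indicator_of_notMem h']
  have hHF (x y : ℝ) (hx0 : 0 < x) (hy0 : 0 < y) : 4 * x * y * H (x ^ 2, y ^ 2) = F (x, y) := by
    have hmem : (x ^ 2, y ^ 2) ∈ Ωstar Ω ↔ (x, y) ∈ Ω := by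
      simp [Ωstar, hx0.le, hy0.le]
    by_cases h : (x, y) ∈ Ω
    · have hxy : √(x ^ 2 * y ^ 2) = x * y := by
        rw [← mul_pow, Real.sqrt_sq (by positivity)]
      rw [hHdef, hFdef, indicator_of_mem h, indicator_of_mem (hmem.mpr h)]
      simp only [W00, hxy, Real.sqrt_sq hx0.le, Real.sqrt_sq hy0.le]
      field_simp
    · rw [hHdef, hFdef, indicator_of_notMem h, indicator_of_notMem (mt hmem.mp h), mul_zero]
  rw [integral_eq_four_mul_integral_Ioi_Ioi hint hx hy] at hzero
  rw [integral_eq_integral_Ioi_Ioi hH hsupp, ← integral_Ioi_Ioi_comp_sq]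
  refine Eq.trans ?_ ((mul_eq_zero.mp hzero).resolve_left four_ne_zero)
  exact setIntegral_congr_fun measurableSet_Ioi fun x hx0 =>
    setIntegral_congr_fun measurableSet_Ioi fun y hy0 => hHF x y hx0 hy0

/-- If `{Sₙ}` is the MOPS of an `xy`-symmetric weight `W` on `Ω` and
`S_{2n+1,2k+1}(x,y) = y s_{n,k}(x²,y²)`, then the `s_{n,k}` are monic with leading
term `u^(n-k) v^k` and the vectors `(s_{n,0},…,s_{n,n})ᵀ` form the MOPS of the weight
`W^(0,1)(u,v) = v W^(0,0)(u,v)` on `Ω*`. -/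
theorem stmt10 (Ω : Set (ℝ × ℝ)) (W : ℝ × ℝ → ℝ) (hW : IsWeight Ω W)
    (hsym : XYSymmetric Ω W)
    (S : (n : ℕ) → Fin (n + 1) → MvPolynomial (Fin 2) ℝ) (hS : IsMOPS Ω W S)
    (s : (n : ℕ) → Fin (n + 1) → MvPolynomial (Fin 2) ℝ)
    (hrel : ∀ (n : ℕ) (k : Fin (n + 1)) (x y : ℝ),
      eval ![x, y] (S (2 * n + 1) ⟨2 * (k : ℕ) + 1, by have := k.isLt; omega⟩) =
        y * eval ![x ^ 2, y ^ 2] (s n k)) :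
    IsMOPS (Ωstar Ω) (fun z => z.2 * W00 W z) s := by
  constructor
  · intro n k
    refine MonicLead.of_eq_X_mul_expand (Nat.lt_succ_iff.mp k.isLt)
      (hS.1 (2 * n + 1) ⟨2 * (k : ℕ) + 1, by omega⟩) (MvPolynomial.funext fun p => ?_)
    have hp : p = ![p 0, p 1] := by ext i; fin_cases i <;> rfl
    have hsq : p ^ 2 = ![p 0 ^ 2, p 1 ^ 2] := by ext i; fin_cases i <;> rfl
    rw [map_mul, eval_X, eval_expand, hsq, ← hrel, ← hp]
  · intro m n hmn i j
    have hprod (p : ℝ × ℝ) :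
        p.2 ^ 2 * (ev (p.1 ^ 2, p.2 ^ 2) (s m i) * ev (p.1 ^ 2, p.2 ^ 2) (s n j)) * W p =
          ev p (S (2 * m + 1) ⟨2 * (i : ℕ) + 1, by omega⟩) *
            ev p (S (2 * n + 1) ⟨2 * (j : ℕ) + 1, by omega⟩) * W p := by
      simp only [ev, hrel]
      ring
    refine integral_Ωstar_eq_zero hW.1 hsym (fun q => ev q (s m i) * ev q (s n j)) ?_ ?_
    · simp only [hprod]
      simpa only [ev, map_mul] using hW.integrableOn_ev_mul
        (S (2 * m + 1) ⟨2 * (i : ℕ) + 1, by omega⟩ * S (2 * n + 1) ⟨2 * (j : ℕ) + 1, by omega⟩)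
    · simp only [hprod]
      exact hS.2 _ _ (by omega) _ _
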